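/- arXiv:math/0504051 — 2 statements merged into one kernel-verified Lean document; each statement's English description precedes it below -/
import Mathlib

section
/- Let G be a (possibly infinite) group and let S and T be finite G-sets. If |S^H| = |T^H| holds for every subgroup H ≤ G of finite index, then S and T are isomorphic as G-sets. (This expresses the injectivity of the composition of the character map of the finite-G-set version of the Burnside ring \overline{A}(G) with the projection onto the factors indexed by finite-index subgroups.) -/
namespace BurnsideAux

variable {G : Type*} [Group G]

/-- The orbit of a point, as an invariant subset. -/
def orb {S : Type*} [MulAction G S] (s : S) : SubMulAction G S where
  carrier := MulAction.orbit G s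
  smul_mem' g x hx := by
    obtain ⟨k, rfl⟩ := hx
    exact ⟨g * k, mul_smul g k s⟩

/-- The complement of an invariant subset. -/
def cpl {S : Type*} [MulAction G S] (A : SubMulAction G S) : SubMulAction G S where
  carrier := (A : Set S)ᶜ
  smul_mem' g x hx := by
    intro h
    apply hx
    have := A.smul_mem g⁻¹ h
    simpa using this

theorem card_split {S : Type*} [MulAction G S] [Finite S] (A : SubMulAction G S)
    (H : Subgroup G) :
    Nat.card (MulAction.fixedPoints H S) =
      Nat.card (MulAction.fixedPoints H A) + Nat.card (MulAction.fixedPoints H (cpl A)) := by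
  classical
  have key : ∀ B : SubMulAction G S, Nat.card (MulAction.fixedPoints H B) =
      (MulAction.fixedPoints H S ∩ (B : Set S)).ncard := by
    intro B
    rw [Nat.card_coe_set_eq, ← Set.ncard_image_of_injective _ Subtype.val_injective]
    congr 1
    ext x
    constructor
    · rintro ⟨y, hy, rfl⟩
      exact ⟨fun g => congrArg Subtype.val (hy g), y.2⟩
    · rintro ⟨h1, h2⟩
      exact ⟨⟨x, h2⟩, fun g => Subtype.ext (h1 g), rfl⟩
  rw [key A, key (cpl A), Nat.card_coe_set_eq]
  have := Set.ncard_inter_add_ncard_sdiff_eq_ncard (MulAction.fixedPoints H S) (A : Set S)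
    (Set.toFinite _)
  rw [← this]
  rfl

theorem card_congr {S T : Type*} [MulAction G S] [MulAction G T] (e : S ≃ T)
    (he : ∀ (g : G) (s : S), e (g • s) = g • e s) (H : Subgroup G) :
    Nat.card (MulAction.fixedPoints H S) = Nat.card (MulAction.fixedPoints H T) := by
  refine Nat.card_congr (e.subtypeEquiv fun a => ?_)
  refine forall_congr' fun g => ?_
  have := he g a
  constructor
  · intro h
    exact this.symm.trans (congrArg e h)
  · intro h
    exact e.injective (this.trans h)

theorem orb_iso {S T : Type*} [MulAction G S] [MulAction G T] (s : S) (t : T)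
    (h : MulAction.stabilizer G s = MulAction.stabilizer G t) :
    ∃ e : orb (G := G) s ≃ orb (G := G) t, ∀ (g : G) (x : orb (G := G) s),
      e (g • x) = g • e x := by
  have hh : ∀ a b : G, a • s = b • s ↔ a • t = b • t := by
    intro a b
    have := SetLike.ext_iff.1 h (b⁻¹ * a)
    simp only [MulAction.mem_stabilizer_iff, mul_smul, inv_smul_eq_iff] at this
    exact this
  let f : orb (G := G) s → orb (G := G) t := fun x => ⟨x.2.choose • t, ⟨_, rfl⟩⟩
  have hf : ∀ (x : orb (G := G) s) (g : G), g • s = x.1 → (f x).1 = g • t := by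
    intro x g hg
    exact (hh _ _).1 (x.2.choose_spec.trans hg.symm)
  have hb : Function.Bijective f := by
    constructor
    · rintro ⟨_, a, rfl⟩ ⟨_, b, rfl⟩ hab
      have h1 := congrArg Subtype.val hab
      rw [hf _ a rfl, hf _ b rfl] at h1
      exact Subtype.ext ((hh _ _).2 h1)
    · rintro ⟨_, a, rfl⟩
      exact ⟨⟨a • s, a, rfl⟩, Subtype.ext (hf _ a rfl)⟩
  refine ⟨Equiv.ofBijective f hb, ?_⟩
  rintro g ⟨_, a, rfl⟩
  apply Subtype.ext
  change (f _).1 = g • (f _).1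
  rw [hf _ (g * a) (mul_smul g a s), mul_smul, hf ⟨_, a, rfl⟩ a rfl]

theorem glue {S T : Type*} [MulAction G S] [MulAction G T] (A : SubMulAction G S)
    (B : SubMulAction G T) (e : A ≃ B) (he : ∀ (g : G) (x : A), e (g • x) = g • e x)
    (f : cpl A ≃ cpl B) (hf : ∀ (g : G) (x : cpl A), f (g • x) = g • f x) :
    ∃ e : S ≃ T, ∀ (g : G) (s : S), e (g • s) = g • e s := by
  classical
  let k : S → T := fun s => if h : s ∈ A then (e ⟨s, h⟩).1 else (f ⟨s, h⟩).1
  have k1 : ∀ x : A, k x.1 = (e x).1 := fun x => dif_pos x.2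
  have k2 : ∀ x : cpl A, k x.1 = (f x).1 := fun x => dif_neg x.2
  have hc : ∀ s : S, (∃ x : A, x.1 = s) ∨ ∃ x : cpl A, x.1 = s := fun s =>
    (em (s ∈ A)).imp (fun h => ⟨⟨s, h⟩, rfl⟩) (fun h => ⟨⟨s, h⟩, rfl⟩)
  have hb : Function.Bijective k := by
    constructor
    · intro a b hab
      rcases hc a with ⟨x, rfl⟩ | ⟨x, rfl⟩ <;> rcases hc b with ⟨y, rfl⟩ | ⟨y, rfl⟩
      · rw [k1, k1] at hab
        rw [e.injective (Subtype.ext hab)]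
      · rw [k1, k2] at hab
        exact absurd (hab ▸ (e x).2) (f y).2
      · rw [k1, k2] at hab
        exact absurd (hab ▸ (e y).2) (f x).2
      · rw [k2, k2] at hab
        rw [f.injective (Subtype.ext hab)]
    · intro t
      by_cases h : t ∈ B
      · exact ⟨(e.symm ⟨t, h⟩).1, by rw [k1]; simp⟩
      · exact ⟨(f.symm ⟨t, h⟩).1, by rw [k2]; simp⟩
  refine ⟨Equiv.ofBijective k hb, fun g s => ?_⟩
  change k (g • s) = g • k s
  rcases hc s with ⟨x, rfl⟩ | ⟨x, rfl⟩
  · rw [k1]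
    exact (k1 (g • x)).trans (congrArg Subtype.val (he g x))
  · rw [k2]
    exact (k2 (g • x)).trans (congrArg Subtype.val (hf g x))

theorem stab_fi {S : Type*} [MulAction G S] [Finite S] (s : S) :
    (MulAction.stabilizer G s).FiniteIndex := by
  haveI : Finite (G ⧸ MulAction.stabilizer G s) :=
    Finite.of_equiv _ (MulAction.orbitEquivQuotientStabilizer G s)
  exact Subgroup.finiteIndex_of_finite_quotient

theorem transfer {S T : Type*} [Finite S] [Finite T] [MulAction G S] [MulAction G T]
    (h : ∀ H : Subgroup G, H.FiniteIndex →
      Nat.card (MulAction.fixedPoints H S) = Nat.card (MulAction.fixedPoints H T)) (s : S) :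
    ∃ t : T, MulAction.stabilizer G s ≤ MulAction.stabilizer G t := by
  have h1 := h _ (stab_fi (G := G) s)
  have : Nonempty (MulAction.fixedPoints (MulAction.stabilizer G s) S) :=
    ⟨⟨s, fun g => g.2⟩⟩
  have h2 : 0 < Nat.card (MulAction.fixedPoints (MulAction.stabilizer G s) T) := by
    rw [← h1]; exact Nat.card_pos
  obtain ⟨⟨t, ht⟩⟩ := (Nat.card_pos_iff.1 h2).1
  exact ⟨t, fun g hg => ht ⟨g, hg⟩⟩

theorem main (n : ℕ) : ∀ (S : Type*) (T : Type*) [Finite S] [Finite T] [MulAction G S]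
    [MulAction G T] (_ : Nat.card S = n)
    (_ : ∀ H : Subgroup G, H.FiniteIndex →
      Nat.card (MulAction.fixedPoints H S) = Nat.card (MulAction.fixedPoints H T)),
    ∃ e : S ≃ T, ∀ (g : G) (s : S), e (g • s) = g • e s := by
  induction n using Nat.strong_induction_on with
  | _ n ih =>
  intro S T _ _ _ _ hn h
  rcases isEmpty_or_nonempty S with hS | hS
  · haveI : IsEmpty T :=
      ⟨fun t => hS.elim (transfer (fun H hH => (h H hH).symm) t).choose⟩
    exact ⟨Equiv.equivOfIsEmpty S T, fun _ s => hS.elim s⟩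
  · obtain ⟨s, hs⟩ := Finite.exists_max (fun s : S => OrderDual.toDual (MulAction.stabilizer G s).index)
    obtain ⟨t, ht⟩ := transfer h s
    obtain ⟨s', hs'⟩ := transfer (fun H hH => (h H hH).symm) t
    have hst : MulAction.stabilizer G s = MulAction.stabilizer G t := by
      haveI := stab_fi (G := G) s
      refine le_antisymm ht ?_
      by_contra hlt
      have h1 : MulAction.stabilizer G s < MulAction.stabilizer G s' :=
        lt_of_lt_of_le (lt_of_le_not_ge ht hlt) hs'
      have h2 := Subgroup.index_strictAnti h1
      have h3 : (MulAction.stabilizer G s).index ≤ (MulAction.stabilizer G s').index := hs s'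
      omega
    obtain ⟨e, he⟩ := orb_iso s t hst
    have hlt : Nat.card (cpl (orb (G := G) s)) < n := by
      rw [← hn]
      refine Finite.card_subtype_lt (x := s) ?_
      intro hx
      exact hx ⟨1, one_smul G s⟩
    obtain ⟨f, hf⟩ := ih _ hlt (cpl (orb (G := G) s)) (cpl (orb (G := G) t)) rfl (by
      intro H hH
      have h1 := h H hH
      rw [card_split (orb (G := G) s) H, card_split (orb (G := G) t) H,
        card_congr e he H] at h1
      exact Nat.add_left_cancel h1)
    exact glue _ _ e he f hf

end BurnsideAux

/-- **Injectivity of the character map of the finite-`G`-set version of the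
Burnside ring `\overline{A}(G)` of an arbitrary group, restricted to the
factors indexed by finite-index subgroups.**  If two finite `G`-sets have the
same number of `H`-fixed points for every finite-index subgroup `H ≤ G`, they
are isomorphic as `G`-sets. -/
theorem burnside_character_injective_finite_index
    (G : Type*) [Group G]
    (S T : Type*) [Finite S] [Finite T] [MulAction G S] [MulAction G T]
    (h : ∀ H : Subgroup G, H.FiniteIndex →
      Nat.card (MulAction.fixedPoints H S) = Nat.card (MulAction.fixedPoints H T)) :
    ∃ e : S ≃ T, ∀ (g : G) (s : S), e (g • s) = g • e s := by
  exact BurnsideAux.main _ S T rfl h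
end

section
/- Let p be a prime, let R = ℤ[X]/(X² + pX), and let I ⊆ R be the ideal generated by the residue class x of X. Then for every integer n ≥ 1 one has Iⁿ = p^{n−1}·I, i.e., the n-th power of the ideal I equals the ideal of all elements p^{n−1}·a with a ∈ I. (Since the Burnside ring A(ℤ/p) is isomorphic to ℤ[X]/(X² + pX) via x ↦ [ℤ/p] − p·[point], with I corresponding to the augmentation ideal I_G, this computes I_G^n = p^{n−1}·I_G and yields A(ℤ/p)^∧_{I_G} ≅ ℤ × ℤ_p.) -/
open Pointwise

/-- The ideal `(X² + pX)` of `ℤ[X]`. -/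
noncomputable def pruefRel (p : ℕ) : Ideal (Polynomial ℤ) :=
  Ideal.span {Polynomial.X ^ 2 + (p : Polynomial ℤ) * Polynomial.X}

/-- The ring `R = ℤ[X]/(X² + pX)`, isomorphic to the Burnside ring `A(ℤ/p)`. -/
abbrev pruefRing (p : ℕ) := Polynomial ℤ ⧸ pruefRel p

/-- The residue class `x` of `X` in `ℤ[X]/(X² + pX)`. -/
noncomputable def xClass (p : ℕ) : pruefRing p :=
  Ideal.Quotient.mk (pruefRel p) Polynomial.X

/-- **Powers of the augmentation ideal of `A(ℤ/p)`.**  In `R = ℤ[X]/(X² + pX)`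
with `I = (x)` the ideal generated by the class of `X`, one has
`Iⁿ = p^{n-1}·I` for every `n ≥ 1`, where `p^{n-1}·I = {p^{n-1}·a : a ∈ I}`. -/
theorem augmentation_ideal_power (p : ℕ) (hp : p.Prime) (n : ℕ) (hn : 1 ≤ n) :
    (Ideal.span {xClass p}) ^ n = ((p : pruefRing p) ^ (n - 1)) • Ideal.span {xClass p} := by
  obtain ⟨k, rfl⟩ : ∃ k, n = k + 1 := ⟨n - 1, by omega⟩
  have h2 : xClass p * xClass p = -(p : pruefRing p) * xClass p := by
    have h : Ideal.Quotient.mk (pruefRel p)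
        (Polynomial.X ^ 2 + (p : Polynomial ℤ) * Polynomial.X) = 0 :=
      Ideal.Quotient.eq_zero_iff_mem.mpr (Ideal.subset_span rfl)
    rw [map_add, map_pow, map_mul, map_natCast] at h
    change xClass p ^ 2 + (p : pruefRing p) * xClass p = 0 at h
    linear_combination h
  have hpow : xClass p ^ (k + 1) = (-1) ^ k * ((p : pruefRing p) ^ k * xClass p) := by
    clear hn
    induction k with
    | zero => simp
    | succ k ih =>
      rw [pow_succ, ih]
      linear_combination (-1) ^ k * (p : pruefRing p) ^ k * h2
  have hs : ((-1 : pruefRing p) ^ k) * (-1) ^ k = 1 := by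
    have h1 : (-1 : pruefRing p) * (-1) = 1 := by ring
    rw [← mul_pow, h1, one_pow]
  rw [Ideal.span_singleton_pow, hpow, Nat.add_sub_cancel]
  ext y
  rw [Submodule.mem_smul_pointwise_iff_exists, Ideal.mem_span_singleton']
  constructor
  · rintro ⟨a, rfl⟩
    refine ⟨a * (-1) ^ k * xClass p, Ideal.mem_span_singleton'.mpr ⟨_, rfl⟩, ?_⟩
    rw [smul_eq_mul]; ring
  · rintro ⟨b, hb, rfl⟩
    obtain ⟨a, rfl⟩ := Ideal.mem_span_singleton'.mp hb
    refine ⟨a * (-1) ^ k, ?_⟩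
    rw [smul_eq_mul]
    linear_combination a * (p : pruefRing p) ^ k * xClass p * hs
end
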